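/- Let t, u ∈ ℂ and let x₁, x₂, x₃, x₄ ∈ SL(2,ℂ) with tr(xᵢ) = t for all i, such that r₁ = r₂ = r₃ = r₄ where rᵢ = xᵢxᵢ₊₁xᵢ⁻¹xᵢ₋₁xᵢ (subscripts modulo 4), each of the triples (x₁,x₂,x₃), (x₁,x₂,x₄), (x₁,x₃,x₄), (x₂,x₃,x₄) is irreducible, tr(xᵢxᵢ₊₁) = u for all i (subscripts modulo 4) with u ≠ 1, tr(x₁x₃) = tr(x₂x₄), and tr(x̌₁x̌₂x̌₃) ≠ 0 where x̌ = x − (tr(x)/2)·I. Then tr(x₁x₃) = 2u + 2 − t², and the number η = tr(x₁x₂x₃) satisfies t·η = u² + u − t² + 1 and η² + t(t² + 4 − 2u)·η − 5t²u + t⁴ + 4t² − 6 = 0. -/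

import Mathlib

open Matrix

local notation "𝕄" => Matrix (Fin 2) (Fin 2) ℂ
local notation "SL2" => Matrix.SpecialLinearGroup (Fin 2) ℂ

/-- A family of 2×2 complex matrices is irreducible if there is no nonzero vector
`v ∈ ℂ²` which is a common eigenvector of all members. -/
def IsIrreducibleFamily {ι : Type*} (x : ι → Matrix (Fin 2) (Fin 2) ℂ) : Prop :=
  ¬ ∃ v : Fin 2 → ℂ, v ≠ 0 ∧ ∀ i, ∃ a : ℂ, (x i).mulVec v = a • v

/-- `x̌ = x − (tr x / 2)·I`, the trace-free part of a 2×2 matrix. -/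
noncomputable def chk (x : Matrix (Fin 2) (Fin 2) ℂ) : Matrix (Fin 2) (Fin 2) ℂ :=
  x - (x.trace / 2) • 1


namespace Aux18

lemma tr_chk (A : Matrix (Fin 2) (Fin 2) ℂ) : (chk A).trace = 0 := by
  simp [chk, trace_fin_two]

lemma tr_chk2 (A B : Matrix (Fin 2) (Fin 2) ℂ) :
    (chk A * chk B).trace = (A * B).trace - A.trace * B.trace / 2 := by
  simp [chk, trace_fin_two, Matrix.mul_apply, Fin.sum_univ_two]; ring

lemma tr_chk3 (A B D : Matrix (Fin 2) (Fin 2) ℂ) :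
    (chk A * chk B * chk D).trace = (A * B * D).trace
      - (A.trace * (B * D).trace + B.trace * (A * D).trace + D.trace * (A * B).trace) / 2
      + A.trace * B.trace * D.trace / 2 := by
  simp [chk, trace_fin_two, Matrix.mul_apply, Fin.sum_univ_two]; ring

/-- Cramer's rule in the three-dimensional space of trace-free matrices. -/
lemma cramer (X Y Z D W : Matrix (Fin 2) (Fin 2) ℂ) (hX : X.trace = 0) (hY : Y.trace = 0)
    (hZ : Z.trace = 0) (hD : D.trace = 0) (hW : W.trace = 0) :
    (X * Y * Z).trace * (D * W).trace = (D * Y * Z).trace * (X * W).trace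
      + (X * D * Z).trace * (Y * W).trace + (X * Y * D).trace * (Z * W).trace := by
  simp only [trace_fin_two] at hX hY hZ hD hW
  have eX := eq_neg_of_add_eq_zero_right hX
  have eY := eq_neg_of_add_eq_zero_right hY
  have eZ := eq_neg_of_add_eq_zero_right hZ
  have eD := eq_neg_of_add_eq_zero_right hD
  have eW := eq_neg_of_add_eq_zero_right hW
  simp only [trace_fin_two, Matrix.mul_apply, Fin.sum_univ_two, eX, eY, eZ, eD, eW]
  ring

/-- The square of the triple product is the Gram determinant. -/
lemma gram (X Y Z : Matrix (Fin 2) (Fin 2) ℂ) (hX : X.trace = 0) (hY : Y.trace = 0)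
    (hZ : Z.trace = 0) (N P Q : ℂ) (hXX : (X * X).trace = N) (hYY : (Y * Y).trace = N)
    (hZZ : (Z * Z).trace = N) (hXY : (X * Y).trace = P) (hYZ : (Y * Z).trace = P)
    (hXZ : (X * Z).trace = Q) :
    (X * Y * Z).trace ^ 2 = -(1 / 2) * ((N - Q) * (N * (N + Q) - 2 * P ^ 2)) := by
  have key : (X * Y * Z).trace ^ 2 = -(1 / 2) * ((X * X).trace * (Y * Y).trace * (Z * Z).trace
      + 2 * (X * Y).trace * (Y * Z).trace * (X * Z).trace
      - (X * X).trace * (Y * Z).trace ^ 2 - (Y * Y).trace * (X * Z).trace ^ 2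
      - (Z * Z).trace * (X * Y).trace ^ 2) := by
    simp only [trace_fin_two] at hX hY hZ
    have eX := eq_neg_of_add_eq_zero_right hX
    have eY := eq_neg_of_add_eq_zero_right hY
    have eZ := eq_neg_of_add_eq_zero_right hZ
    simp only [trace_fin_two, Matrix.mul_apply, Fin.sum_univ_two, eX, eY, eZ]
    ring
  rw [key, hXX, hYY, hZZ, hXY, hYZ, hXZ]; ring

/-- Equilateral quadrilaterals with equal diagonals in three-space. -/
lemma quad (X Y Z D : Matrix (Fin 2) (Fin 2) ℂ) (hX : X.trace = 0) (hY : Y.trace = 0)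
    (hZ : Z.trace = 0) (hD : D.trace = 0) (N P Q : ℂ)
    (hXX : (X * X).trace = N) (hYY : (Y * Y).trace = N)
    (hZZ : (Z * Z).trace = N) (hDD : (D * D).trace = N)
    (hXY : (X * Y).trace = P) (hYZ : (Y * Z).trace = P) (hZD : (Z * D).trace = P)
    (hDX : (D * X).trace = P) (hXZ : (X * Z).trace = Q) (hYD : (Y * D).trace = Q)
    (hs : (X * Y * Z).trace ≠ 0) :
    N ≠ Q ∧ ((N + Q = 2 * P ∧ (X * Y * D).trace = (X * Y * Z).trace) ∨
      (N + Q = -(2 * P) ∧ (X * Y * D).trace = -(X * Y * Z).trace)) := by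
  have hg := gram X Y Z hX hY hZ N P Q hXX hYY hZZ hXY hYZ hXZ
  have cX := cramer X Y Z D X hX hY hZ hD hX
  have cY := cramer X Y Z D Y hX hY hZ hD hY
  have cZ := cramer X Y Z D Z hX hY hZ hD hZ
  have cD := cramer X Y Z D D hX hY hZ hD hD
  rw [hDX, hXX, trace_mul_comm Y X, hXY, trace_mul_comm Z X, hXZ] at cX
  rw [trace_mul_comm D Y, hYD, hXY, hYY, trace_mul_comm Z Y, hYZ] at cY
  rw [trace_mul_comm D Z, hZD, hXZ, hYZ, hZZ] at cZ
  rw [hDD, trace_mul_comm X D, hDX, hYD, hZD] at cD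
  generalize (X * Y * Z).trace = s at *
  generalize (D * Y * Z).trace = α at *
  generalize (X * D * Z).trace = β at *
  generalize (X * Y * D).trace = γ at *
  have hNQ : N ≠ Q := by
    rintro rfl
    apply hs
    have : s ^ 2 = 0 := by rw [hg]; ring
    exact pow_eq_zero_iff (two_ne_zero) |>.1 this
  have hNQ' : N - Q ≠ 0 := sub_ne_zero.2 hNQ
  have hαγ : α = γ := by
    have : (N - Q) * (α - γ) = 0 := by linear_combination cZ - cX
    exact sub_eq_zero.1 ((mul_eq_zero.1 this).resolve_left hNQ')
  have hβ : β = -s := by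
    have : (N - Q) * (β + s) = 0 := by linear_combination cD - cY
    exact eq_neg_of_add_eq_zero_left ((mul_eq_zero.1 this).resolve_left hNQ')
  subst hαγ hβ
  have e1 : 2 * s * P = α * (N + Q) := by linear_combination cX
  have e2 : s * (N + Q) = 2 * α * P := by linear_combination cD
  refine ⟨hNQ, ?_⟩
  have hsq : (s - α) * (s + α) = 0 := by
    by_contra hne
    have hP : P = 0 := by
      have : ((s - α) * (s + α)) * P = 0 := by linear_combination (s / 2) * e1 + (α / 2) * e2
      exact (mul_eq_zero.1 this).resolve_left hne
    have hQ : N + Q = 0 := by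
      have : ((s - α) * (s + α)) * (N + Q) = 0 := by linear_combination α * e1 + s * e2
      exact (mul_eq_zero.1 this).resolve_left hne
    apply hs
    have : s ^ 2 = 0 := by rw [hg, hP, hQ]; ring
    exact pow_eq_zero_iff (two_ne_zero) |>.1 this
  rcases mul_eq_zero.1 hsq with h | h
  · left
    have hα : α = s := by linear_combination -h
    subst hα
    exact ⟨mul_left_cancel₀ hs (by linear_combination e2), rfl⟩
  · right
    have hα : α = -s := by linear_combination h
    subst hα
    exact ⟨mul_left_cancel₀ hs (by linear_combination e2), rfl⟩

lemma aba (A B : Matrix (Fin 2) (Fin 2) ℂ) (t u : ℂ) (hA : A.det = 1) (hB : B.trace = t)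
    (hAB : (A * B).trace = u) : A * B * A = u • A - t • 1 + B := by
  have key : A * B * A = (A * B).trace • A - (A.det * B.trace) • 1 + A.det • B := by
    ext i j
    fin_cases i <;> fin_cases j <;>
      simp [det_fin_two, trace_fin_two, Matrix.mul_apply, Fin.sum_univ_two] <;> ring
  rw [key, hA, hB, hAB, one_mul, one_smul]

lemma rform (A B D : Matrix (Fin 2) (Fin 2) ℂ) (t u : ℂ) (hA : A.det = 1)
    (htA : A.trace = t) (htB : B.trace = t) (htD : D.trace = t)
    (hAB : (A * B).trace = u) (hAD : (A * D).trace = u) :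
    A * B * A.adjugate * D * A =
      t • (A * B * D * A) - u • (u • A - t • 1 + D) + t • (D * A) - B * D * A := by
  have hadj : A.adjugate = t • 1 - A := by
    rw [← htA]
    ext i j
    fin_cases i <;> fin_cases j <;> simp [adjugate_fin_two, trace_fin_two]
  have h1 : A * B * A.adjugate * D * A = t • (A * B * D * A) - (A * B * A) * D * A := by
    rw [hadj]; simp [mul_sub, sub_mul]
  have h2 : (u • A - t • 1 + B) * D * A = u • (A * D * A) - t • (D * A) + B * D * A := by
    simp [sub_mul, add_mul]
  rw [h1, aba A B t u hA htB hAB, h2, aba A D t u hA htD hAD]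
  abel

lemma w1 (A B D : Matrix (Fin 2) (Fin 2) ℂ) :
    (A * B * D * A).trace = A.trace * (A * B * D).trace - A.det * (B * D).trace := by
  simp [det_fin_two, trace_fin_two, Matrix.mul_apply, Fin.sum_univ_two]; ring

lemma w2 (A B D : Matrix (Fin 2) (Fin 2) ℂ) :
    (A * B * D * A * A).trace = (A.trace ^ 2 - A.det) * (A * B * D).trace
      - A.trace * A.det * (B * D).trace := by
  simp [det_fin_two, trace_fin_two, Matrix.mul_apply, Fin.sum_univ_two]; ring

lemma w3 (A B C : Matrix (Fin 2) (Fin 2) ℂ) :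
    (B * C * A * B * A).trace = (A * B).trace * (A * B * C).trace
      - A.det * B.det * C.trace := by
  simp [det_fin_two, trace_fin_two, Matrix.mul_apply, Fin.sum_univ_two]; ring

lemma w4 (A B C : Matrix (Fin 2) (Fin 2) ℂ) :
    (C * A * B * A).trace = (A * B).trace * (A * C).trace
      - A.det * B.trace * C.trace + A.det * (B * C).trace := by
  simp [det_fin_two, trace_fin_two, Matrix.mul_apply, Fin.sum_univ_two]; ring

lemma w5 (A B D : Matrix (Fin 2) (Fin 2) ℂ) :
    (A * B * D * A * B).trace = (A * B).trace * (A * B * D).trace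
      - A.det * B.det * D.trace := by
  simp [det_fin_two, trace_fin_two, Matrix.mul_apply, Fin.sum_univ_two]; ring

lemma w6 (A B : Matrix (Fin 2) (Fin 2) ℂ) :
    (B * A * A).trace = A.trace * (B * A).trace - A.det * B.trace := by
  simp [det_fin_two, trace_fin_two, Matrix.mul_apply, Fin.sum_univ_two]; ring

lemma w7 (A : Matrix (Fin 2) (Fin 2) ℂ) :
    (A * A).trace = A.trace ^ 2 - 2 * A.det := by
  simp [det_fin_two, trace_fin_two, Matrix.mul_apply, Fin.sum_univ_two]; ring

lemma cyc (A B C : Matrix (Fin 2) (Fin 2) ℂ) : (B * C * A).trace = (A * B * C).trace := by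
  rw [trace_mul_comm, ← mul_assoc]

/-- The trace equations extracted from `r₁ = r₂`. -/
lemma eqs (A B C D : Matrix (Fin 2) (Fin 2) ℂ) (t u v δ η : ℂ)
    (hA : A.det = 1) (hB : B.det = 1)
    (htA : A.trace = t) (htB : B.trace = t) (htC : C.trace = t) (htD : D.trace = t)
    (hAB : (A * B).trace = u) (hBC : (B * C).trace = u) (hDA : (D * A).trace = u)
    (hAC : (A * C).trace = v) (hBD : (B * D).trace = v)
    (hδ : (A * B * D).trace = δ) (hη : (A * B * C).trace = η)
    (hr : A * B * A.adjugate * D * A = B * C * B.adjugate * A * B) :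
    (t ^ 2 - 1) * (δ - η) = 0 ∧
    t * ((t ^ 2 - 1) * δ - t * v) - u * (u * (t ^ 2 - 2) - t ^ 2 + u) + t * (t * u - t)
        - (t * δ - v) =
      t * (u * η - t) - u * (u * u - t ^ 2 + (t ^ 2 - 2)) + t * (t * u - t)
        - (u * v - t ^ 2 + u) ∧
    t * (u * δ - t) - u * (u * u - t ^ 2 + v) + t * δ - (t * δ - u) =
      t * ((t ^ 2 - 1) * η - t * v) - u * (u * (t ^ 2 - 2) - t ^ 2 + u) + t * (t * u - t)
        - (t * η - v) := by
  have hAD : (A * D).trace = u := by rw [trace_mul_comm, hDA]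
  have hBA : (B * A).trace = u := by rw [trace_mul_comm, hAB]
  have hCA : (C * A).trace = v := by rw [trace_mul_comm, hAC]
  have hDB : (D * B).trace = v := by rw [trace_mul_comm, hBD]
  have hBDA : (B * D * A).trace = δ := by rw [cyc, hδ]
  have hDAB : (D * A * B).trace = δ := by rw [cyc, hBDA]
  have hBCA : (B * C * A).trace = η := by rw [cyc, hη]
  have hCAB : (C * A * B).trace = η := by rw [cyc, hBCA]
  rw [rform A B D t u hA htA htB htD hAB hAD, rform B C A t u hB htB htC htA hBC hBA] at hr
  have hABA : (A * B * A).trace = t * u - t := by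
    rw [← cyc A B A, w6, htB, hA, hBA, htA]; ring
  have hBCABA : (B * C * A * B * A).trace = u * η - t := by
    rw [w3, hAB, hη, hA, hB, htC]; ring
  have hBDAA : (B * D * A * A).trace = t * δ - v := by
    rw [w6, hBDA, hBD, htA, hA]; ring
  have hBDAB : (B * D * A * B).trace = t * δ - u := by
    rw [w1, hBDA, hDA, htB, hB]; ring
  have hCABB : (C * A * B * B).trace = t * η - v := by
    rw [w6, hCAB, hCA, htB, hB]; ring
  have e0 := congrArg Matrix.trace hr
  have eA := congrArg (fun M => (M * A).trace) hr
  have eB := congrArg (fun M => (M * B).trace) hr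
  simp only [add_mul, sub_mul, smul_mul_assoc, one_mul, trace_add, trace_sub, trace_smul,
    smul_eq_mul] at e0 eA eB
  simp only [hBCABA] at eA
  simp only [w1, w2, w4, w5, hBDAA, hBDAB, hCABB] at e0 eA eB
  simp only [w6, w7, hABA, htA, htB, htC, htD, hA, hB, hAB, hBC, hDA, hAC, hBD, hδ, hBA,
    hCA, hDB, hBDA, hDAB, hBCA, hCAB, trace_one, Fintype.card_fin] at e0 eA eB
  push_cast at e0 eA eB
  refine ⟨?_, ?_, ?_⟩
  · linear_combination e0
  · linear_combination eA
  · linear_combination eB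

/-- The statement on the level of traces of matrices. -/
lemma final (A B C D : Matrix (Fin 2) (Fin 2) ℂ) (t u v δ η : ℂ)
    (hA : A.det = 1) (hB : B.det = 1) (hC : C.det = 1) (hD : D.det = 1)
    (htA : A.trace = t) (htB : B.trace = t) (htC : C.trace = t) (htD : D.trace = t)
    (hAB : (A * B).trace = u) (hBC : (B * C).trace = u) (hCD : (C * D).trace = u)
    (hDA : (D * A).trace = u)
    (hAC : (A * C).trace = v) (hBD : (B * D).trace = v)
    (hδ : (A * B * D).trace = δ) (hη : (A * B * C).trace = η)
    (hr : A * B * A.adjugate * D * A = B * C * B.adjugate * A * B) (hu : u ≠ 1)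
    (hs : (chk A * chk B * chk C).trace ≠ 0) :
    v = 2 * u + 2 - t ^ 2 ∧ t * η = u ^ 2 + u - t ^ 2 + 1 ∧
      η ^ 2 + t * (t ^ 2 + 4 - 2 * u) * η - 5 * t ^ 2 * u + t ^ 4 + 4 * t ^ 2 - 6 = 0 := by
  obtain ⟨e0, eA, eB⟩ := eqs A B C D t u v δ η hA hB htA htB htC htD hAB hBC hDA hAC hBD hδ hη hr
  have hAD : (A * D).trace = u := by rw [trace_mul_comm, hDA]
  have sq : ∀ M : Matrix (Fin 2) (Fin 2) ℂ, M.det = 1 → M.trace = t →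
      (chk M * chk M).trace = t ^ 2 / 2 - 2 := by
    intro M h1 h2
    rw [tr_chk2, w7, h1, h2]; ring
  have pr : ∀ (M N : Matrix (Fin 2) (Fin 2) ℂ) (w : ℂ), M.trace = t → N.trace = t →
      (M * N).trace = w → (chk M * chk N).trace = w - t ^ 2 / 2 := by
    intro M N w h1 h2 h3
    rw [tr_chk2, h1, h2, h3]; ring
  have hg := gram (chk A) (chk B) (chk C) (tr_chk A) (tr_chk B) (tr_chk C) _ _ _
    (sq A hA htA) (sq B hB htB) (sq C hC htC) (pr A B u htA htB hAB) (pr B C u htB htC hBC)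
    (pr A C v htA htC hAC)
  obtain ⟨hNQ, hq⟩ := quad (chk A) (chk B) (chk C) (chk D) (tr_chk A) (tr_chk B) (tr_chk C)
    (tr_chk D) _ _ _
    (sq A hA htA) (sq B hB htB) (sq C hC htC) (sq D hD htD)
    (pr A B u htA htB hAB) (pr B C u htB htC hBC) (pr C D u htC htD hCD) (pr D A u htD htA hDA)
    (pr A C v htA htC hAC) (pr B D v htB htD hBD) hs
  simp only [tr_chk3, htA, htB, htC, htD, hAB, hBC, hAC, hBD, hAD, hδ, hη] at hg hq hs
  rcases hq with ⟨h1, h2⟩ | ⟨h1, h2⟩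
  · have hv : v = 2 * u + 2 - t ^ 2 := by linear_combination h1
    have hδη : δ = η := by linear_combination h2
    subst hδη hv
    have hne : t ^ 2 - u - 2 ≠ 0 := by
      intro h
      apply hNQ
      linear_combination 2 * h
    have hη' : t * δ = u ^ 2 + u - t ^ 2 + 1 := by
      have : (t ^ 2 - u - 2) * (t * δ - (u ^ 2 + u - t ^ 2 + 1)) = 0 := by
        linear_combination eA
      exact sub_eq_zero.1 ((mul_eq_zero.1 this).resolve_left hne)
    refine ⟨rfl, hη', ?_⟩
    linear_combination hg - (t ^ 2 - 2 * u - 6) * hη'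
  · exfalso
    have hv : v = t ^ 2 - 2 * u + 2 := by linear_combination h1
    have hδη : δ = 2 * t - η := by subst hv; linear_combination h2
    subst hv hδη
    have hη0 : η - t ≠ 0 := by
      intro h
      apply hs
      linear_combination h
    have ht : t ^ 2 = 1 := by
      have : (η - t) * (t ^ 2 - 1) = 0 := by linear_combination -(1 / 2) * e0
      exact sub_eq_zero.1 ((mul_eq_zero.1 this).resolve_left hη0)
    have h3 : (u - 1) * (1 - t * η) = 0 := by
      linear_combination (1 / 2) * (eA + eB) - (t ^ 2 + u - 1 - t * η) * ht
    have h4 : 1 - t * η = 0 := (mul_eq_zero.1 h3).resolve_left (sub_ne_zero.2 hu)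
    apply hη0
    linear_combination -t * h4 - η * ht
end Aux18

/-- On the excellent component: if all `tr(xᵢxᵢ₊₁) = u ≠ 1`,
`tr(x₁x₃) = tr(x₂x₄)` and `tr(x̌₁x̌₂x̌₃) ≠ 0`, then `tr(x₁x₃) = 2u + 2 − t²` and
`η = tr(x₁x₂x₃)` satisfies `tη = u² + u − t² + 1` and
`η² + t(t² + 4 − 2u)η − 5t²u + t⁴ + 4t² − 6 = 0`. -/
theorem stmt18 (t u : ℂ) (x₁ x₂ x₃ x₄ : SL2)
    (hx₁ : ((x₁ : 𝕄)).trace = t) (hx₂ : ((x₂ : 𝕄)).trace = t)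
    (hx₃ : ((x₃ : 𝕄)).trace = t) (hx₄ : ((x₄ : 𝕄)).trace = t)
    (hr₁₂ : x₁ * x₂ * x₁⁻¹ * x₄ * x₁ = x₂ * x₃ * x₂⁻¹ * x₁ * x₂)
    (hr₂₃ : x₂ * x₃ * x₂⁻¹ * x₁ * x₂ = x₃ * x₄ * x₃⁻¹ * x₂ * x₃)
    (hr₃₄ : x₃ * x₄ * x₃⁻¹ * x₂ * x₃ = x₄ * x₁ * x₄⁻¹ * x₃ * x₄)
    (hirr₁₂₃ : IsIrreducibleFamily ![(x₁ : 𝕄), (x₂ : 𝕄), (x₃ : 𝕄)])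
    (hirr₁₂₄ : IsIrreducibleFamily ![(x₁ : 𝕄), (x₂ : 𝕄), (x₄ : 𝕄)])
    (hirr₁₃₄ : IsIrreducibleFamily ![(x₁ : 𝕄), (x₃ : 𝕄), (x₄ : 𝕄)])
    (hirr₂₃₄ : IsIrreducibleFamily ![(x₂ : 𝕄), (x₃ : 𝕄), (x₄ : 𝕄)])
    (hu₁₂ : ((x₁ * x₂ : SL2) : 𝕄).trace = u) (hu₂₃ : ((x₂ * x₃ : SL2) : 𝕄).trace = u)
    (hu₃₄ : ((x₃ * x₄ : SL2) : 𝕄).trace = u) (hu₄₁ : ((x₄ * x₁ : SL2) : 𝕄).trace = u)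
    (hu : u ≠ 1)
    (h1324 : ((x₁ * x₃ : SL2) : 𝕄).trace = ((x₂ * x₄ : SL2) : 𝕄).trace)
    (hs : (chk (x₁ : 𝕄) * chk (x₂ : 𝕄) * chk (x₃ : 𝕄)).trace ≠ 0) :
    ((x₁ * x₃ : SL2) : 𝕄).trace = 2 * u + 2 - t ^ 2 ∧
    ∀ η : ℂ, η = ((x₁ * x₂ * x₃ : SL2) : 𝕄).trace →
      t * η = u ^ 2 + u - t ^ 2 + 1 ∧
      η ^ 2 + t * (t ^ 2 + 4 - 2 * u) * η - 5 * t ^ 2 * u + t ^ 4 + 4 * t ^ 2 - 6 = 0 := by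
  have hr : (x₁ : 𝕄) * x₂ * (x₁ : 𝕄).adjugate * x₄ * x₁
      = (x₂ : 𝕄) * x₃ * (x₂ : 𝕄).adjugate * x₁ * x₂ :=
    congrArg (fun x : SL2 => (x : 𝕄)) hr₁₂
  obtain ⟨h1, h2, h3⟩ := Aux18.final (x₁ : 𝕄) x₂ x₃ x₄ t u _ _ _ x₁.2 x₂.2 x₃.2
    x₄.2 hx₁ hx₂ hx₃ hx₄ hu₁₂ hu₂₃ hu₃₄ hu₄₁ rfl h1324.symm rfl rfl hr hu hs
  refine ⟨h1, ?_⟩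
  rintro η rfl
  exact ⟨h2, h3⟩
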